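/- arXiv:2308.12775 — 3 statements merged into one kernel-verified Lean document; each statement's English description precedes it below -/
import Mathlib

section
/- Let M, P ∈ ℝ^{d×d} be symmetric positive semidefinite matrices. Then I + M·P is invertible, where I is the d×d identity matrix. -/
open Matrix

/-- If `M` and `P` are symmetric positive semidefinite `d×d` real matrices, then `I + M·P`
is invertible. -/
theorem one_add_psd_mul_psd_isUnit (d : ℕ)
    (M P : Matrix (Fin d) (Fin d) ℝ) (hM : M.PosSemidef) (hP : P.PosSemidef) :
    IsUnit (1 + M * P) := by
  rw [← mulVec_injective_iff_isUnit, ← coe_mulVecLin, injective_iff_map_eq_zero]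
  intro x hx
  rw [mulVecLin_apply, add_mulVec, one_mulVec, ← mulVec_mulVec] at hx
  have hsum : (P *ᵥ x) ⬝ᵥ x + (P *ᵥ x) ⬝ᵥ (M *ᵥ (P *ᵥ x)) = 0 := by
    rw [← dotProduct_add, hx, dotProduct_zero]
  have hMnonneg := hM.dotProduct_mulVec_nonneg (P *ᵥ x)
  have hPnonneg := hP.dotProduct_mulVec_nonneg x
  rw [star_trivial] at hMnonneg hPnonneg
  rw [dotProduct_comm (P *ᵥ x) x] at hsum
  have hPx : P *ᵥ x = 0 := by
    rw [← hP.dotProduct_mulVec_zero_iff, star_trivial]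
    linarith
  simpa [hPx] using hx
end

section
/- Let R ∈ ℝ^{m×m} be symmetric positive definite, P, Q ∈ ℝ^{d×d} symmetric positive semidefinite, F ∈ ℝ^{d×d} and G ∈ ℝ^{d×m}. Then the Riccati update Q + Fᵀ P F − Fᵀ P G (R + Gᵀ P G)⁻¹ Gᵀ P F is symmetric positive semidefinite. -/
open Matrix

/-- The Joseph form of the Riccati update: for a gain `K` solving the normal equation
`(R + GᵀPG)K = GᵀPF`, the update is a sum of congruences of `P` and `R`. -/
theorem transpose_mul_mul_sub_eq_joseph_form {m d α : Type*} [Fintype m] [Fintype d]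
    [CommRing α] {R : Matrix m m α} {P F : Matrix d d α} {G : Matrix d m α} {K : Matrix m d α}
    (hK : (R + Gᵀ * P * G) * K = Gᵀ * P * F) :
    Fᵀ * P * F - Fᵀ * P * G * K = (F - G * K)ᵀ * P * (F - G * K) + Kᵀ * R * K := by
  have h : Kᵀ * R * K + Kᵀ * Gᵀ * P * G * K = Kᵀ * Gᵀ * P * F := by
    simpa only [Matrix.add_mul, Matrix.mul_add, Matrix.mul_assoc] using congrArg (Kᵀ * ·) hK
  rw [← sub_eq_zero, ← sub_eq_zero.mpr h.symm]
  simp only [transpose_sub, transpose_mul, Matrix.sub_mul, Matrix.mul_sub, Matrix.mul_assoc]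
  abel

/-- The discrete-time Riccati update `Q + FᵀPF − FᵀPG(R + GᵀPG)⁻¹GᵀPF` of symmetric positive
semidefinite matrices `P, Q` (with `R` symmetric positive definite) is again symmetric
positive semidefinite. -/
theorem riccati_update_posSemidef (m d : ℕ)
    (R : Matrix (Fin m) (Fin m) ℝ) (P Q : Matrix (Fin d) (Fin d) ℝ)
    (F : Matrix (Fin d) (Fin d) ℝ) (G : Matrix (Fin d) (Fin m) ℝ)
    (hR : R.PosDef) (hP : P.PosSemidef) (hQ : Q.PosSemidef) :
    (Q + Fᵀ * P * F - Fᵀ * P * G * (R + Gᵀ * P * G)⁻¹ * Gᵀ * P * F).PosSemidef := by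
  have hS : IsUnit (R + Gᵀ * P * G).det :=
    (Matrix.isUnit_iff_isUnit_det _).mp
      (hR.add_posSemidef (by simpa using hP.conjTranspose_mul_mul_same G)).isUnit
  set K := (R + Gᵀ * P * G)⁻¹ * (Gᵀ * P * F) with hK
  have hKF : (R + Gᵀ * P * G) * K = Gᵀ * P * F := Matrix.mul_nonsing_inv_cancel_left _ _ hS
  have hassoc : Fᵀ * P * G * (R + Gᵀ * P * G)⁻¹ * Gᵀ * P * F = Fᵀ * P * G * K := by
    simp only [hK, Matrix.mul_assoc]
  rw [hassoc, add_sub_assoc, transpose_mul_mul_sub_eq_joseph_form hKF]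
  simpa only [conjTranspose_eq_transpose_of_trivial] using
    hQ.add ((hP.conjTranspose_mul_mul_same (F - G * K)).add
      (hR.posSemidef.conjTranspose_mul_mul_same K))
end

section
/- (Open-loop Nash equilibrium of the linear quadratic discrete-time game, underlying Theorem 1.) Consider N players, a state dimension d, input dimensions m₁, …, m_N, matrices F ∈ ℝ^{d×d} and G^i ∈ ℝ^{d×m_i}, symmetric positive definite R^i ∈ ℝ^{m_i×m_i}, symmetric positive semidefinite Q^i_k ∈ ℝ^{d×d} for k = 1, …, T+1 and each i, and an initial state x₀ ∈ ℝ^{d}. Given input sequences u^j = (u^j_0, …, u^j_T) for all players, the state evolves as x_{k+1} = F x_k + Σ_{j=1}^{N} G^j u^j_k, and player i's cost is J^i(u¹, …, u^N) = (1/2) Σ_{k=0}^{T} ( x_{k+1}ᵀ Q^i_{k+1} x_{k+1} + u^i_kᵀ R^i u^i_k ). Define the coupled Riccati recursion backward by P^i_{T+1} = Q^i_{T+1} and P^i_k = Fᵀ P^i_{k+1} Λ_k⁻¹ F + Q^i_k, where Λ_k = I + Σ_{j=1}^{N} G^j (R^j)⁻¹ G^{jᵀ} P^j_{k+1}, and assume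 Λ_k is invertible for every k = 0, …, T. Then the controls u^{i★}_k = −(R^i)⁻¹ G^{iᵀ} P^i_{k+1} Λ_k⁻¹ F x★_k, where x★_0 = x₀ and x★_{k+1} = Λ_k⁻¹ F x★_k, form an open-loop Nash equilibrium: for every player i and every alternative input sequence u^i, J^i(u^{1★}, …, u^{N★}) ≤ J^i(u^{1★}, …, u^{(i−1)★}, u^i, u^{(i+1)★}, …, u^{N★}). -/
open Matrix

/-- State trajectory of the `N`-player linear game `x_{k+1} = F x_k + Σ_j G^j u^j_k` from
initial state `x0` under the collection of input sequences `u`. -/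
def gameTraj {d N : ℕ} {m : Fin N → ℕ} (F : Matrix (Fin d) (Fin d) ℝ)
    (G : ∀ i, Matrix (Fin d) (Fin (m i)) ℝ) (x0 : Fin d → ℝ)
    (u : ∀ i, ℕ → Fin (m i) → ℝ) : ℕ → Fin d → ℝ
  | 0 => x0
  | k + 1 => F.mulVec (gameTraj F G x0 u k) + ∑ j, (G j).mulVec (u j k)

/-- Cost of player `i` in the linear quadratic discrete-time game:
`J^i(u) = (1/2) Σ_{k=0}^{T} (x_{k+1}ᵀ Q^i_{k+1} x_{k+1} + u^i_kᵀ R^i u^i_k)`. -/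
noncomputable def gameCost {d N : ℕ} {m : Fin N → ℕ} (F : Matrix (Fin d) (Fin d) ℝ)
    (G : ∀ i, Matrix (Fin d) (Fin (m i)) ℝ)
    (R : ∀ i, Matrix (Fin (m i)) (Fin (m i)) ℝ)
    (Q : Fin N → ℕ → Matrix (Fin d) (Fin d) ℝ) (x0 : Fin d → ℝ) (T : ℕ)
    (i : Fin N) (u : ∀ j, ℕ → Fin (m j) → ℝ) : ℝ :=
  (1 / 2) * ∑ k ∈ Finset.range (T + 1),
    (gameTraj F G x0 u (k + 1) ⬝ᵥ (Q i (k + 1)).mulVec (gameTraj F G x0 u (k + 1))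
      + u i k ⬝ᵥ (R i).mulVec (u i k))

/-- A positive semidefinite quadratic form lies above its tangent hyperplanes. -/
theorem Matrix.PosSemidef.quadForm_tangent_le {n : Type*} [Fintype n] {A : Matrix n n ℝ}
    (hA : A.PosSemidef) (a b : n → ℝ) :
    a ⬝ᵥ A *ᵥ a + 2 * ((b - a) ⬝ᵥ A *ᵥ a) ≤ b ⬝ᵥ A *ᵥ b := by
  have hnn : 0 ≤ (b - a) ⬝ᵥ A *ᵥ (b - a) := by
    simpa using hA.dotProduct_mulVec_nonneg (b - a)
  have hsymm : a ⬝ᵥ A *ᵥ b = b ⬝ᵥ A *ᵥ a := by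
    have hT : Aᵀ = A := by simpa using hA.isHermitian.eq
    conv_lhs => rw [← hT, dotProduct_transpose_mulVec]
  simp only [mulVec_sub, dotProduct_sub, sub_dotProduct] at hnn ⊢
  linarith

/-- The deviation of the state trajectory caused by a unilateral deviation of player `i` evolves
by the linear system driven by the input deviation. -/
theorem gameTraj_update_sub_succ {d N : ℕ} {m : Fin N → ℕ} (F : Matrix (Fin d) (Fin d) ℝ)
    (G : ∀ i, Matrix (Fin d) (Fin (m i)) ℝ) (x0 : Fin d → ℝ)
    (u : ∀ i, ℕ → Fin (m i) → ℝ) (i : Fin N) (ui : ℕ → Fin (m i) → ℝ) (k : ℕ) :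
    gameTraj F G x0 (Function.update u i ui) (k + 1) - gameTraj F G x0 u (k + 1) =
      F *ᵥ (gameTraj F G x0 (Function.update u i ui) k - gameTraj F G x0 u k) +
        G i *ᵥ (ui k - u i k) := by
  have hsum : ∑ j, G j *ᵥ Function.update u i ui j k - ∑ j, G j *ᵥ u j k =
      G i *ᵥ (ui k - u i k) := by
    rw [← Finset.sum_sub_distrib, Finset.sum_eq_single i]
    · simp [mulVec_sub]
    · intro j _ hj
      simp [Function.update_of_ne hj]
    · simp
  rw [← hsum, mulVec_sub]
  simp only [gameTraj]
  abel

/-- Sufficiency of the discrete-time Pontryagin conditions for the linear quadratic game: if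
player `i`'s input is stationary along a costate `p`, no unilateral deviation lowers its cost. -/
theorem gameCost_le_update_of_costate {d N : ℕ} {m : Fin N → ℕ} (F : Matrix (Fin d) (Fin d) ℝ)
    (G : ∀ i, Matrix (Fin d) (Fin (m i)) ℝ)
    (R : ∀ i, Matrix (Fin (m i)) (Fin (m i)) ℝ)
    (Q : Fin N → ℕ → Matrix (Fin d) (Fin d) ℝ) (x0 : Fin d → ℝ) (T : ℕ)
    (i : Fin N) (u : ∀ j, ℕ → Fin (m j) → ℝ) (p : ℕ → Fin d → ℝ)
    (hR : (R i).PosSemidef) (hQ : ∀ k, 1 ≤ k → k ≤ T + 1 → (Q i k).PosSemidef)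
    (hpT : p (T + 1) = Q i (T + 1) *ᵥ gameTraj F G x0 u (T + 1))
    (hp : ∀ k, 1 ≤ k → k ≤ T → p k = Fᵀ *ᵥ p (k + 1) + Q i k *ᵥ gameTraj F G x0 u k)
    (hu : ∀ k ≤ T, R i *ᵥ u i k = -((G i)ᵀ *ᵥ p (k + 1))) (ui : ℕ → Fin (m i) → ℝ) :
    gameCost F G R Q x0 T i u ≤ gameCost F G R Q x0 T i (Function.update u i ui) := by
  have hz := gameTraj_update_sub_succ F G x0 u i ui
  unfold gameCost
  rw [Function.update_self]
  set x := gameTraj F G x0 u with hx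
  set y := gameTraj F G x0 (Function.update u i ui) with hy
  let D : ℕ → ℝ := fun k =>
    (y (k + 1) - x (k + 1)) ⬝ᵥ Q i (k + 1) *ᵥ x (k + 1) + (ui k - u i k) ⬝ᵥ R i *ᵥ u i k
  have hinput : ∀ k ≤ T, (ui k - u i k) ⬝ᵥ R i *ᵥ u i k =
      (F *ᵥ (y k - x k)) ⬝ᵥ p (k + 1) - (y (k + 1) - x (k + 1)) ⬝ᵥ p (k + 1) := by
    intro k hk
    rw [hu k hk, hz k, dotProduct_neg, add_dotProduct, dotProduct_transpose_mulVec,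
      dotProduct_comm (p (k + 1))]
    ring
  have htel : ∀ n ≤ T, ∑ k ∈ Finset.range n, D k = -((F *ᵥ (y n - x n)) ⬝ᵥ p (n + 1)) := by
    intro n
    induction n with
    | zero => intro _; simp [hx, hy, gameTraj]
    | succ n ih =>
      intro hn
      have hpz : (y (n + 1) - x (n + 1)) ⬝ᵥ p (n + 1) =
          (F *ᵥ (y (n + 1) - x (n + 1))) ⬝ᵥ p (n + 1 + 1) +
            (y (n + 1) - x (n + 1)) ⬝ᵥ Q i (n + 1) *ᵥ x (n + 1) := by
        conv_lhs => rw [hp (n + 1) (by lia) hn]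
        rw [dotProduct_add, dotProduct_transpose_mulVec, dotProduct_comm (p (n + 1 + 1))]
      rw [Finset.sum_range_succ, ih (by lia)]
      simp only [D]
      rw [hinput n (by lia), hpz]
      ring
  have hD : ∑ k ∈ Finset.range (T + 1), D k = 0 := by
    rw [Finset.sum_range_succ, htel T le_rfl]
    simp only [D]
    rw [hinput T le_rfl, hpT]
    ring
  refine mul_le_mul_of_nonneg_left ?_ (by norm_num)
  rw [← add_zero (∑ k ∈ Finset.range (T + 1), (x (k + 1) ⬝ᵥ _ + _)), ← mul_zero (2 : ℝ), ← hD,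
    Finset.mul_sum, ← Finset.sum_add_distrib]
  refine Finset.sum_le_sum fun k hk => ?_
  have hQk := (hQ (k + 1) (by lia)
    (Finset.mem_range.1 hk)).quadForm_tangent_le (x (k + 1)) (y (k + 1))
  have hRk := hR.quadForm_tangent_le (u i k) (ui k)
  simp only [D]
  linarith

/-- Open-loop Nash equilibrium of the linear quadratic discrete-time game: the controls
`u^{i★}_k = −(R^i)⁻¹ G^{iᵀ} P^i_{k+1} Λ_k⁻¹ F x★_k` obtained from the coupled Riccati
recursion `P^i_k = Fᵀ P^i_{k+1} Λ_k⁻¹ F + Q^i_k`, `Λ_k = I + Σ_j G^j (R^j)⁻¹ G^{jᵀ} P^j_{k+1}`,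
form an open-loop Nash equilibrium: no player can lower its cost by unilaterally deviating. -/
theorem lqdtg_open_loop_nash (d N T : ℕ) (m : Fin N → ℕ)
    (F : Matrix (Fin d) (Fin d) ℝ)
    (G : ∀ i, Matrix (Fin d) (Fin (m i)) ℝ)
    (R : ∀ i, Matrix (Fin (m i)) (Fin (m i)) ℝ) (hR : ∀ i, (R i).PosDef)
    (Q : Fin N → ℕ → Matrix (Fin d) (Fin d) ℝ)
    (hQ : ∀ i, ∀ k, 1 ≤ k → k ≤ T + 1 → (Q i k).PosSemidef)
    (x0 : Fin d → ℝ)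
    (P : Fin N → ℕ → Matrix (Fin d) (Fin d) ℝ)
    (Λ : ℕ → Matrix (Fin d) (Fin d) ℝ)
    (hΛ : ∀ k, Λ k = 1 + ∑ j, G j * (R j)⁻¹ * (G j)ᵀ * P j (k + 1))
    (hΛinv : ∀ k ≤ T, IsUnit (Λ k))
    (hPT : ∀ i, P i (T + 1) = Q i (T + 1))
    (hP : ∀ i, ∀ k, 1 ≤ k → k ≤ T → P i k = Fᵀ * P i (k + 1) * (Λ k)⁻¹ * F + Q i k)
    (xstar : ℕ → Fin d → ℝ) (hx0 : xstar 0 = x0)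
    (hxstar : ∀ k, xstar (k + 1) = ((Λ k)⁻¹ * F).mulVec (xstar k))
    (ustar : ∀ i, ℕ → Fin (m i) → ℝ)
    (hustar : ∀ i k,
        ustar i k = -(((R i)⁻¹ * (G i)ᵀ * P i (k + 1) * (Λ k)⁻¹ * F).mulVec (xstar k))) :
    ∀ i : Fin N, ∀ ui : ℕ → Fin (m i) → ℝ,
      gameCost F G R Q x0 T i ustar ≤ gameCost F G R Q x0 T i (Function.update ustar i ui) := by
  have hstep : ∀ k ≤ T, Λ k *ᵥ xstar (k + 1) = F *ᵥ xstar k := by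
    intro k hk
    rw [hxstar, mulVec_mulVec, ← Matrix.mul_assoc,
      mul_nonsing_inv _ ((isUnit_iff_isUnit_det _).1 (hΛinv k hk)), Matrix.one_mul]
  have hu : ∀ i k, ustar i k = -((R i)⁻¹ *ᵥ (G i)ᵀ *ᵥ P i (k + 1) *ᵥ xstar (k + 1)) := by
    intro i k
    simp only [hustar, hxstar, mulVec_mulVec, Matrix.mul_assoc]
  have htraj : ∀ k ≤ T + 1, gameTraj F G x0 ustar k = xstar k := by
    intro k
    induction k with
    | zero => intro _; exact hx0.symm
    | succ k ih =>
      intro hk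
      have hsum : ∑ j, G j *ᵥ ustar j k = xstar (k + 1) - Λ k *ᵥ xstar (k + 1) := by
        rw [hΛ, add_mulVec, one_mulVec, sum_mulVec]
        simp [hu, mulVec_neg, mulVec_mulVec, Matrix.mul_assoc]
      simp only [gameTraj]
      rw [ih (by lia), hsum, hstep k (by lia)]
      abel
  intro i ui
  refine gameCost_le_update_of_costate F G R Q x0 T i ustar (fun k => P i k *ᵥ xstar k)
    (hR i).posSemidef (hQ i) ?_ ?_ ?_ ui
  · simp only [hPT, htraj (T + 1) le_rfl]
  · intro k hk hkT
    simp only [htraj k (by lia), hxstar k]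
    conv_lhs => rw [hP i k hk hkT]
    simp only [add_mulVec, mulVec_mulVec, Matrix.mul_assoc]
  · intro k _
    rw [hu, mulVec_neg, mulVec_mulVec,
      mul_nonsing_inv _ ((isUnit_iff_isUnit_det _).1 (hR i).isUnit), one_mulVec]
end
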